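/- Let E be a directed graph, let P be a proper partition of E^1 (in the in-splitting sense), let d_{r,P} be the associated Drinen range-vector, and let {s_f, p_w} be a Cuntz-Krieger d_{r,P}(E)-family in a C*-algebra A. With the convention s_{f(v)_0} = p_{v_0}, define T_e = s_e for e with m(s(e)) = 0, T_{e_j} = s_{f(s(e))_{j-1}} ⋯ s_{f(s(e))_1} s_e for 1 ≤ j ≤ m(s(e)), Q_{v_i} = p_{v_{i-1}} for 1 ≤ i ≤ m(v), and Q_v = p_{v_0} if m(v) = 0. Then: (a) for every v ∈ E^0 that is not a sink and has finite valency, and every j with 1 ≤ j ≤ m(v) − 1, one has Σ_{e ∈ E^1 : s(e) = v} T_{e_{j+1}} T_{e_j}^* = s_{f(v)_j}; and (b) every s_f (f ∈ d_{r,P}(E)^1) and every p_w (w ∈ d_{r,P}(E)^0) lies in C*(T_g, Q_u), the smallest norm-closed star-subalgebra of A containing all T_g and Q_u. -/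

import Mathlib

/-! Statement 8: a Cuntz-Krieger family for the in-delayed graph `d_{r,P}(E)` associated
to a proper in-splitting gives rise to a Cuntz-Krieger family for the in-split graph
`E_r(P)`. -/

/-- A Cuntz-Krieger family for the directed graph with vertex type `V`, edge type `E`,
range map `r` and source map `s`, inside a C*-algebra `A`.  The relation
`S e S e* ≤ P (s e)` is phrased algebraically (for projections `p ≤ q ↔ p * q = p`). -/
structure CKFamily {A : Type} [NonUnitalCStarAlgebra A] {V E : Type}
    (r s : E → V) (S : E → A) (P : V → A) : Prop where
  partialIsom : ∀ e, S e * star (S e) * S e = S e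
  orthoRanges : ∀ e f, e ≠ f → (S e * star (S e)) * (S f * star (S f)) = 0
  projIdem : ∀ v, P v * P v = P v
  projSelfAdj : ∀ v, star (P v) = P v
  orthoProj : ∀ v w, v ≠ w → P v * P w = 0
  ck1 : ∀ e, star (S e) * S e = P (r e)
  ck2 : ∀ e, (S e * star (S e)) * P (s e) = S e * star (S e)
  ck3 : ∀ v, {e | s e = v}.Nonempty → {e | s e = v}.Finite →
      P v = ∑ᶠ e ∈ {e | s e = v}, S e * star (S e)

section InDelay

variable {V E : Type} (r s : E → V) (d : V → ℕ∞) (dE : E → ℕ)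

/-- Vertices of the in-delayed graph `d_r(E)`: pairs `v_i = (v, i)` with
`0 ≤ i ≤ d_r v`. -/
def IDVert : Type := {p : V × ℕ // (p.2 : ℕ∞) ≤ d p.1}

/-- Edges of the in-delayed graph: the original edges `e ∈ E^1` together with the
delay edges `f(v)_i`, `1 ≤ i ≤ d_r v`, encoded as pairs `(v, i)`. -/
def IDEdge (E : Type) {V : Type} (d : V → ℕ∞) : Type :=
  E ⊕ {p : V × ℕ // 1 ≤ p.2 ∧ (p.2 : ℕ∞) ≤ d p.1}

/-- The vertex `v_0` of the in-delayed graph. -/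
def idVert0 (v : V) : IDVert d := ⟨(v, 0), by simp⟩

/-- The source map of the in-delayed graph: `s(e) = s(e)_0` and `s(f(v)_i) = v_i`. -/
def idSrc : IDEdge E d → IDVert d
  | .inl e => idVert0 d (s e)
  | .inr g => ⟨g.1, g.2.2⟩

/-- The range map of the in-delayed graph: `r(e) = r(e)_{d_r e}` and
`r(f(v)_i) = v_{i-1}`.  (The hypothesis `hrd`, that `d_r e ≤ d_r (r e)`, holds for the
Drinen range-vector associated to an in-splitting.) -/
def idRng (hrd : ∀ e, (dE e : ℕ∞) ≤ d (r e)) : IDEdge E d → IDVert d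
  | .inl e => ⟨(r e, dE e), hrd e⟩
  | .inr g => ⟨(g.1.1, g.1.2 - 1), le_trans (by exact_mod_cast Nat.sub_le _ _) g.2.2⟩

end InDelay

section InSplit

variable {V E : Type} (r s : E → V) (m : V → ℕ∞) (idx : E → ℕ)

/-- Vertices of the in-split graph `E_r(P)`: pairs `v_i = (v, i)` with `1 ≤ i ≤ m v`,
together with the sources `v`, encoded as `(v, 0)` when `m v = 0`. -/
def ISVert : Type :=
  {p : V × ℕ // (p.2 = 0 ∧ m p.1 = 0) ∨ (1 ≤ p.2 ∧ (p.2 : ℕ∞) ≤ m p.1)}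

/-- Edges of the in-split graph: pairs `e_j = (e, j)` with `1 ≤ j ≤ m (s e)`, together
with the edges `e` out of sources, encoded as `(e, 0)` when `m (s e) = 0`. -/
def ISEdge : Type :=
  {p : E × ℕ // (p.2 = 0 ∧ m (s p.1) = 0) ∨ (1 ≤ p.2 ∧ (p.2 : ℕ∞) ≤ m (s p.1))}

/-- The source map of the in-split graph: `s(e_j) = s(e)_j` (and `s(e) = s(e)` for
sources). -/
def isSrc : ISEdge s m → ISVert m := fun g => ⟨(s g.1.1, g.1.2), g.2⟩

/-- The range map of the in-split graph: `r(e_j) = r(e)_i` where `e ∈ 𝓔^{r e}_i`,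
i.e. `i = idx e`. -/
def isRng (hidx : ∀ e, 1 ≤ idx e ∧ (idx e : ℕ∞) ≤ m (r e)) :
    ISEdge s m → ISVert m :=
  fun g => ⟨(r g.1.1, idx g.1.1), Or.inr (hidx g.1.1)⟩

variable {A : Type} [NonUnitalCStarAlgebra A]

/-- `descChain g x n = g n * g (n-1) * ⋯ * g 1 * x` for `n ≥ 1`, and
`descChain g x 0 = g 0 * x`. -/
def descChain (g : ℕ → A) (x : A) : ℕ → A
  | 0 => g 0 * x
  | 1 => g 1 * x
  | n + 2 => g (n + 2) * descChain g x (n + 1)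

open scoped Classical in
/-- `T_{e_j} = s_{f(s e)_{j-1}} ⋯ s_{f(s e)_1} s_e` for `1 ≤ j ≤ m (s e)` (with the
convention `s_{f(v)_0} = p_{v_0}`, implemented by the `else` branch of the inner `if`),
and `T_e = s_e` when `m (s e) = 0` (encoded as `j = 0`). -/
noncomputable def TIS (Sp : IDEdge E (fun v => m v - 1) → A)
    (Pp : IDVert (fun v => m v - 1) → A) (e : E) (j : ℕ) : A :=
  if j = 0 then Sp (.inl e)
  else
    descChain
      (fun k => if hk : 1 ≤ k ∧ (k : ℕ∞) ≤ m (s e) - 1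
        then Sp (.inr ⟨(s e, k), hk⟩)
        else Pp (idVert0 (fun v => m v - 1) (s e)))
      (Sp (.inl e)) (j - 1)

/-- `Q_{v_i} = p_{v_{i-1}}` for `1 ≤ i ≤ m v`, and `Q_v = p_{v_0}` when `m v = 0`
(encoded as `i = 0`, with `0 - 1 = 0`). -/
noncomputable def QIS (Pp : IDVert (fun v => m v - 1) → A) (u : ISVert m) : A :=
  Pp ⟨(u.1.1, u.1.2 - 1), by
    rcases u.2 with ⟨h0, _⟩ | ⟨h1, h2⟩
    · simp [h0]
    · have : ((u.1.2 - 1 : ℕ) : ℕ∞) = (u.1.2 : ℕ∞) - 1 := by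
        rw [ENat.coe_sub, Nat.cast_one]
      rw [this]
      exact tsub_le_tsub_right h2 1⟩

end InSplit

namespace CKFamily

variable {A : Type} [NonUnitalCStarAlgebra A] {V E : Type} {r s : E → V} {S : E → A} {P : V → A}

theorem mul_rangeProj (h : CKFamily r s S P) (e : E) : S e * P (r e) = S e := by
  rw [← h.ck1, ← mul_assoc, h.partialIsom]

theorem sourceProj_mul (h : CKFamily r s S P) (e : E) : P (s e) * S e = S e := by
  have h2 : P (s e) * (S e * star (S e)) = S e * star (S e) := by
    simpa [h.projSelfAdj] using congrArg star (h.ck2 e)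
  rw [← h.partialIsom e, ← mul_assoc, h2]

theorem mul_star_eq_of_unique (h : CKFamily r s S P) (e : E)
    (he : ∀ f, s f = s e → f = e) : S e * star (S e) = P (s e) := by
  have hset : {f | s f = s e} = {e} := by
    ext f
    exact ⟨he f, fun hf => congrArg s hf⟩
  have h3 := h.ck3 (s e)
  rw [hset] at h3
  simpa using (h3 (Set.singleton_nonempty e) (Set.finite_singleton e)).symm

end CKFamily

section InSplitFamily

variable {A : Type} [NonUnitalCStarAlgebra A] {V E : Type} {r s : E → V} {m : V → ℕ∞}
  {dE : E → ℕ} {hrd : ∀ e, (dE e : ℕ∞) ≤ m (r e) - 1}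
  {Sp : IDEdge E (fun v => m v - 1) → A} {Pp : IDVert (fun v => m v - 1) → A}

theorem TIS_one (hfam : CKFamily (idRng r (fun v => m v - 1) dE hrd)
    (idSrc s (fun v => m v - 1)) Sp Pp) (e : E) : TIS s m Sp Pp e 1 = Sp (.inl e) := by
  simpa [TIS, descChain, idSrc] using hfam.sourceProj_mul (.inl e)

theorem TIS_add_two (hfam : CKFamily (idRng r (fun v => m v - 1) dE hrd)
    (idSrc s (fun v => m v - 1)) Sp Pp) (e : E) (n : ℕ) {v : V} (hv : s e = v)
    (hn : 1 ≤ n + 1 ∧ ((n + 1 : ℕ) : ℕ∞) ≤ m v - 1) :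
    TIS s m Sp Pp e (n + 2) = Sp (.inr ⟨(v, n + 1), hn⟩) * TIS s m Sp Pp e (n + 1) := by
  subst hv
  cases n with
  | zero =>
    rw [TIS_one hfam]
    unfold TIS
    rw [if_neg (by omega)]
    change (dite _ _ _) * _ = _
    rw [dif_pos hn]
  | succ n =>
    unfold TIS
    rw [if_neg (by omega), if_neg (by omega)]
    change (dite _ _ _) * _ = _
    rw [dif_pos hn]
    rfl

theorem delayEdge_mul_proj (hfam : CKFamily (idRng r (fun v => m v - 1) dE hrd)
    (idSrc s (fun v => m v - 1)) Sp Pp) (v : V) (n : ℕ)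
    (hn : 1 ≤ n + 1 ∧ ((n + 1 : ℕ) : ℕ∞) ≤ m v - 1) (hn' : (n : ℕ∞) ≤ m v - 1) :
    Sp (.inr ⟨(v, n + 1), hn⟩) * Pp ⟨(v, n), hn'⟩ = Sp (.inr ⟨(v, n + 1), hn⟩) :=
  hfam.mul_rangeProj (.inr ⟨(v, n + 1), hn⟩)

theorem delayEdge_mul_star (hfam : CKFamily (idRng r (fun v => m v - 1) dE hrd)
    (idSrc s (fun v => m v - 1)) Sp Pp) (v : V) (n : ℕ)
    (hn : 1 ≤ n + 1 ∧ ((n + 1 : ℕ) : ℕ∞) ≤ m v - 1) :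
    Sp (.inr ⟨(v, n + 1), hn⟩) * star (Sp (.inr ⟨(v, n + 1), hn⟩)) =
      Pp ⟨(v, n + 1), hn.2⟩ := by
  refine hfam.mul_star_eq_of_unique (.inr ⟨(v, n + 1), hn⟩) ?_
  rintro (e | ⟨⟨w, k⟩, hk⟩) hf
  · have := congrArg (fun x => x.1.2) hf
    simp [idSrc, idVert0] at this
  · have h1 : (w, k) = (v, n + 1) := congrArg (fun x => x.1) hf
    cases h1
    rfl

theorem sum_proj_source (hfam : CKFamily (idRng r (fun v => m v - 1) dE hrd)
    (idSrc s (fun v => m v - 1)) Sp Pp) (v : V) (hne : {e | s e = v}.Nonempty)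
    (hfin : {e | s e = v}.Finite) :
    ∑ e ∈ hfin.toFinset, Sp (.inl e) * star (Sp (.inl e)) = Pp (idVert0 _ v) := by
  have hset : {f | idSrc s (fun v => m v - 1) f = idVert0 _ v} =
      (Sum.inl : E → IDEdge E (fun v => m v - 1)) '' {e | s e = v} := by
    ext f
    constructor
    · rcases f with e | ⟨⟨w, k⟩, hk⟩
      · intro hf
        exact ⟨e, congrArg (fun x : IDVert (fun v => m v - 1) => x.1.1) hf, rfl⟩
      · intro hf
        have h1 : k = 0 := congrArg (fun x : IDVert (fun v => m v - 1) => x.1.2) hf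
        have h2 : 1 ≤ k := hk.1
        omega
    · rintro ⟨e, he, rfl⟩
      exact congrArg (idVert0 (fun v => m v - 1)) he
  have h3 := hfam.ck3 (idVert0 _ v)
  rw [hset] at h3
  refine (finsum_mem_eq_finite_toFinset_sum _ hfin).symm.trans ?_
  exact (finsum_mem_image (f := fun f => Sp f * star (Sp f))
    (g := (Sum.inl : E → IDEdge E (fun v => m v - 1)))
    Sum.inl_injective.injOn).symm.trans (h3 (hne.image _) (hfin.image _)).symm

theorem sum_TIS_mul_star_of_sum_eq (hfam : CKFamily (idRng r (fun v => m v - 1) dE hrd)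
    (idSrc s (fun v => m v - 1)) Sp Pp) (v : V) (hfin : {e | s e = v}.Finite) (n : ℕ)
    (hn : 1 ≤ n + 1 ∧ ((n + 1 : ℕ) : ℕ∞) ≤ m v - 1) (hn' : (n : ℕ∞) ≤ m v - 1)
    (hsum : ∑ e ∈ hfin.toFinset, TIS s m Sp Pp e (n + 1) * star (TIS s m Sp Pp e (n + 1)) =
      Pp ⟨(v, n), hn'⟩) :
    ∑ e ∈ hfin.toFinset, TIS s m Sp Pp e (n + 2) * star (TIS s m Sp Pp e (n + 1)) =
      Sp (.inr ⟨(v, n + 1), hn⟩) := by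
  rw [← delayEdge_mul_proj hfam v n hn hn', ← hsum, Finset.mul_sum]
  refine Finset.sum_congr rfl fun e he => ?_
  rw [TIS_add_two hfam e n (by simpa using he) hn, mul_assoc]

theorem sum_TIS_mul_star_self (hfam : CKFamily (idRng r (fun v => m v - 1) dE hrd)
    (idSrc s (fun v => m v - 1)) Sp Pp) (v : V) (hne : {e | s e = v}.Nonempty)
    (hfin : {e | s e = v}.Finite) (n : ℕ) (hn : (n : ℕ∞) ≤ m v - 1) :
    ∑ e ∈ hfin.toFinset, TIS s m Sp Pp e (n + 1) * star (TIS s m Sp Pp e (n + 1)) =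
      Pp ⟨(v, n), hn⟩ := by
  induction n with
  | zero =>
    simp only [zero_add, TIS_one hfam]
    exact sum_proj_source hfam v hne hfin
  | succ n ih =>
    have hn' : (n : ℕ∞) ≤ m v - 1 := le_trans (by exact_mod_cast Nat.le_succ n) hn
    have hn1 : 1 ≤ n + 1 ∧ ((n + 1 : ℕ) : ℕ∞) ≤ m v - 1 := ⟨by omega, hn⟩
    have key := sum_TIS_mul_star_of_sum_eq hfam v hfin n hn1 hn' (ih hn')
    rw [← delayEdge_mul_star hfam v n hn1]
    conv_rhs => rw [← key, Finset.sum_mul]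
    rw [key]
    refine Finset.sum_congr rfl fun e he => ?_
    nth_rewrite 2 [TIS_add_two hfam e n (by simpa using he) hn1]
    rw [star_mul, mul_assoc]

theorem sum_TIS_mul_star (hfam : CKFamily (idRng r (fun v => m v - 1) dE hrd)
    (idSrc s (fun v => m v - 1)) Sp Pp) (v : V) (hne : {e | s e = v}.Nonempty)
    (hfin : {e | s e = v}.Finite) (j : ℕ) (hj : 1 ≤ j ∧ (j : ℕ∞) ≤ m v - 1) :
    ∑ e ∈ hfin.toFinset, TIS s m Sp Pp e (j + 1) * star (TIS s m Sp Pp e j) =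
      Sp (.inr ⟨(v, j), hj⟩) := by
  obtain ⟨n, rfl⟩ : ∃ n, j = n + 1 := ⟨j - 1, by have := hj.1; omega⟩
  have hn' : (n : ℕ∞) ≤ m v - 1 := le_trans (by exact_mod_cast Nat.le_succ n) hj.2
  exact sum_TIS_mul_star_of_sum_eq hfam v hfin n hj hn'
    (sum_TIS_mul_star_self hfam v hne hfin n hn')

end InSplitFamily

theorem ENat.add_one_le_of_le_sub_one {a b : ℕ∞} (hb : b ≠ 0) (h : a ≤ b - 1) : a + 1 ≤ b :=
  (add_le_add_left h 1).trans_eq (tsub_add_cancel_of_le (Order.one_le_iff_ne_zero.2 hb))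

/-- Let `E` be a directed graph, `𝓟` a proper partition of `E^1` in
the in-splitting sense, `d_{r,𝓟}` the associated Drinen range-vector and `{s_f, p_w}` a
Cuntz-Krieger `d_{r,𝓟}(E)`-family in a C*-algebra `A`.  With `T` and `Q` defined as in
Statement 8 (using the convention `s_{f(v)_0} = p_{v_0}`):
(a) for every vertex `v` which is not a sink and has finite valency, and every
`1 ≤ j ≤ m v - 1`, `∑_{s e = v} T_{e_{j+1}} T_{e_j}^* = s_{f(v)_j}`; and
(b) every `s_f` and every `p_w` lies in `C*(T_g, Q_u)`, the smallest norm-closed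
star-subalgebra of `A` containing all the `T_g` and `Q_u`. -/
theorem insplit_sum_formula_and_generators {A : Type} [NonUnitalCStarAlgebra A]
    {V E : Type} [Countable V] [Countable E] (r s : E → V)
    (m : V → ℕ∞) (idx : E → ℕ)
    (hsrc : ∀ v, m v = 0 ↔ {e | r e = v} = ∅)
    (hidx : ∀ e, 1 ≤ idx e ∧ (idx e : ℕ∞) ≤ m (r e))
    (hcls : ∀ v k, 1 ≤ k → (k : ℕ∞) ≤ m v → ∃ e, r e = v ∧ idx e = k)
    (hproper : ∀ v, ({e | s e = v} = ∅ ∨ {e | s e = v}.Infinite) → m v ≤ 1)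
    (hrd : ∀ e, ((idx e - 1 : ℕ) : ℕ∞) ≤ m (r e) - 1)
    (Sp : IDEdge E (fun v => m v - 1) → A) (Pp : IDVert (fun v => m v - 1) → A)
    (hfam : CKFamily (idRng r (fun v => m v - 1) (fun e => idx e - 1) hrd)
      (idSrc s (fun v => m v - 1)) Sp Pp) :
    (∀ v : V, {e | s e = v}.Nonempty → {e | s e = v}.Finite →
      ∀ (j : ℕ) (hj1 : 1 ≤ j) (hj2 : (j : ℕ∞) ≤ m v - 1),
        ∑ᶠ e ∈ {e | s e = v},
            TIS s m Sp Pp e (j + 1) * star (TIS s m Sp Pp e j) =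
          Sp (.inr ⟨(v, j), ⟨hj1, hj2⟩⟩)) ∧
    ((∀ f : IDEdge E (fun v => m v - 1), Sp f ∈
        (NonUnitalStarAlgebra.adjoin ℂ
          (Set.range (fun g : ISEdge s m => TIS s m Sp Pp g.1.1 g.1.2) ∪
            Set.range (QIS m Pp))).topologicalClosure) ∧
      (∀ w : IDVert (fun v => m v - 1), Pp w ∈
        (NonUnitalStarAlgebra.adjoin ℂ
          (Set.range (fun g : ISEdge s m => TIS s m Sp Pp g.1.1 g.1.2) ∪
            Set.range (QIS m Pp))).topologicalClosure)) := by
  have ha : ∀ v : V, {e | s e = v}.Nonempty → ∀ hfin : {e | s e = v}.Finite,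
      ∀ (j : ℕ) (hj : 1 ≤ j ∧ (j : ℕ∞) ≤ m v - 1),
        ∑ e ∈ hfin.toFinset, TIS s m Sp Pp e (j + 1) * star (TIS s m Sp Pp e j) =
          Sp (.inr ⟨(v, j), hj⟩) := sum_TIS_mul_star hfam
  refine ⟨fun v hne hfin j hj1 hj2 => ?_, ?_⟩
  · rw [finsum_mem_eq_finite_toFinset_sum _ hfin, ha v hne hfin j ⟨hj1, hj2⟩]
  let B := NonUnitalStarAlgebra.adjoin ℂ
    (Set.range (fun g : ISEdge s m => TIS s m Sp Pp g.1.1 g.1.2) ∪ Set.range (QIS m Pp))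
  have hT : ∀ (e : E) (j : ℕ), ((j = 0 ∧ m (s e) = 0) ∨ (1 ≤ j ∧ (j : ℕ∞) ≤ m (s e))) →
      TIS s m Sp Pp e j ∈ B := fun e j h =>
    NonUnitalStarAlgebra.subset_adjoin ℂ _ (Or.inl ⟨⟨(e, j), h⟩, rfl⟩)
  have hQ : ∀ u, QIS m Pp u ∈ B := fun u =>
    NonUnitalStarAlgebra.subset_adjoin ℂ _ (Or.inr ⟨u, rfl⟩)
  refine ⟨fun f => B.le_topologicalClosure ?_, fun w => B.le_topologicalClosure ?_⟩
  · rcases f with e | ⟨⟨v, j⟩, hj⟩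
    · by_cases h0 : m (s e) = 0
      · simpa [TIS] using hT e 0 (Or.inl ⟨rfl, h0⟩)
      · rw [← TIS_one hfam]
        exact hT e 1 (Or.inr ⟨le_rfl, by simpa [Order.one_le_iff_ne_zero] using h0⟩)
    · have hj1 : 1 ≤ j := hj.1
      have hj2 : (j : ℕ∞) ≤ m v - 1 := hj.2
      have hjpos : (1 : ℕ∞) ≤ m v - 1 := le_trans (by exact_mod_cast hj1) hj2
      have hm0 : m v ≠ 0 := by
        intro h
        simp [h] at hjpos
      have hm1 : ¬ m v ≤ 1 := by
        intro h
        simp [tsub_eq_zero_of_le h] at hjpos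
      have hjm : ((j + 1 : ℕ) : ℕ∞) ≤ m v := by
        exact_mod_cast ENat.add_one_le_of_le_sub_one hm0 hj2
      have hv := mt (hproper v) hm1
      rw [not_or, Set.not_infinite] at hv
      rw [← ha v (Set.nonempty_iff_ne_empty.2 hv.1) hv.2 j hj]
      refine sum_mem fun e he => ?_
      have hse : s e = v := by simpa using he
      subst hse
      exact mul_mem (hT e _ (Or.inr ⟨by omega, hjm⟩))
        (star_mem (hT e _ (Or.inr ⟨hj1, hj2.trans tsub_le_self⟩)))
  · obtain ⟨⟨v, i⟩, hi⟩ := w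
    by_cases h0 : m v = 0
    · have hi0 : i = 0 := by simpa [h0] using hi
      subst hi0
      exact hQ ⟨(v, 0), Or.inl ⟨rfl, h0⟩⟩
    · exact hQ ⟨(v, i + 1), Or.inr ⟨by simp, by
        exact_mod_cast ENat.add_one_le_of_le_sub_one h0 hi⟩⟩
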